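/- arXiv:2603.10769 — 6 statements merged into one kernel-verified Lean document; each statement's English description precedes it below -/
import Mathlib

section
/- Let F be a field, let N, K, T be positive integers with K ≤ N and T ≤ N, let α_1, …, α_N ∈ F be pairwise distinct, and let v_1, …, v_N, w_1, …, w_N ∈ F be nonzero. For a positive integer k and weights u, let GRS_k(α,u) := { (u_1·h(α_1), …, u_N·h(α_N)) : h ∈ F[X], deg h < k } ⊆ F^N. Then: (1) the F-linear span of the set of all componentwise products c ⋆ c' with c ∈ GRS_K(α,v) and c' ∈ GRS_T(α,w) equals GRS_{min(K+T−1,N)}(α, v⋆w), where (v⋆w)_n = v_n·w_n, and this subspace of F^N has dimension min(K+T−1, N); (2) consequently, for any ℓ ≥ 1 and matrices W ∈ F^{ℓ×K}, U ∈ F^{ℓ×T}, setting x_{i,n} := Σ_{k=1}^K W_{i,k}·v_n·α_n^{k−1} and y_{i,n} := Σ_{t=1}^T U_{i,t}·w_n·α_n^{t−1}, the vector ( Σ_{i=1}^ℓ x_{i,n}·y_{i,n} )_{n=1}^N belongs to GRS_{min(K+T−1,N)}(α, v⋆w). In particular, the N inner products ⟨x_n, y_n⟩ contain exactly max{N−K−T+1,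 0} redundant symbols. -/
/-- The generalized Reed–Solomon code `GRS_k(α, u)` of length `N`: all vectors
`(u 1 * p(α 1), …, u N * p(α N))` where `p` ranges over polynomials of degree `< k`. -/
def GRSCode (F : Type*) [Field F] (N k : ℕ) (α u : Fin N → F) : Set (Fin N → F) :=
  { c | ∃ p : Polynomial F, p.degree < (k : ℕ) ∧ ∀ n, c n = u n * p.eval (α n) }

open Polynomial in
/-- Encoding of a polynomial: evaluation at `α`, scaled by `u`. -/
noncomputable def grsEncode {F : Type*} [Field F] {N : ℕ} (α u : Fin N → F) :
    F[X] →ₗ[F] (Fin N → F) where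
  toFun p n := u n * p.eval (α n)
  map_add' p q := by ext n; simp [mul_add]
  map_smul' a p := by ext n; simp [mul_left_comm]

section GRS

open Polynomial

variable {F : Type*} [Field F] {N : ℕ} {α u v w : Fin N → F}

theorem grsEncode_apply (p : F[X]) (n : Fin N) :
    grsEncode α u p n = u n * p.eval (α n) := rfl

theorem grsEncode_mul (p q : F[X]) :
    grsEncode α (v * w) (p * q) = grsEncode α v p * grsEncode α w q := by
  ext n
  simp only [grsEncode_apply, Pi.mul_apply, eval_mul]
  ring

theorem GRSCode_eq_map (k : ℕ) :
    GRSCode F N k α u = ((degreeLT F k).map (grsEncode α u) : Set (Fin N → F)) := by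
  ext c
  simp only [GRSCode, Set.mem_ofPred_eq, Submodule.map_coe, Set.mem_image, SetLike.mem_coe,
    mem_degreeLT, funext_iff, grsEncode_apply, eq_comm]

theorem GRSCode_mono {k m : ℕ} (h : k ≤ m) : GRSCode F N k α u ⊆ GRSCode F N m α u := by
  rintro c ⟨p, hp, hc⟩
  exact ⟨p, hp.trans_le (by exact_mod_cast h), hc⟩

theorem GRSCode_min_length (hα : Function.Injective α) (m : ℕ) :
    GRSCode F N (min m N) α u = GRSCode F N m α u := by
  refine (GRSCode_mono (min_le_left _ _)).antisymm ?_
  rcases le_total m N with h | h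
  · rw [min_eq_left h]
  · rw [min_eq_right h]
    rintro c ⟨p, -, hc⟩
    refine ⟨Lagrange.interpolate Finset.univ α (fun n => p.eval (α n)), ?_, fun n => ?_⟩
    · simpa using Lagrange.degree_interpolate_lt (fun n => p.eval (α n))
        (hα.injOn (s := (Finset.univ : Finset (Fin N))))
    · rw [hc, Lagrange.eval_interpolate_at_node _ hα.injOn (Finset.mem_univ n)]

theorem mul_mem_GRSCode {K T : ℕ} {c d : Fin N → F} (hK : 1 ≤ K) (hT : 1 ≤ T)
    (hc : c ∈ GRSCode F N K α v) (hd : d ∈ GRSCode F N T α w) :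
    c * d ∈ GRSCode F N (K + T - 1) α (v * w) := by
  obtain ⟨k, rfl⟩ := Nat.exists_eq_add_of_le' hK
  obtain ⟨t, rfl⟩ := Nat.exists_eq_add_of_le' hT
  obtain ⟨p, hp, hc⟩ := hc
  obtain ⟨q, hq, hd⟩ := hd
  refine ⟨p * q, ?_, fun n => ?_⟩
  · rw [← mem_degreeLT, degreeLT_succ_eq_degreeLE, mem_degreeLE] at hp hq
    rw [show k + 1 + (t + 1) - 1 = (k + t) + 1 by omega, ← mem_degreeLT,
      degreeLT_succ_eq_degreeLE, mem_degreeLE]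
    exact_mod_cast degree_mul_le_of_le hp hq
  · simp only [Pi.mul_apply, hc, hd, eval_mul]
    ring

theorem span_mul_GRSCode {K T : ℕ} (hK : 1 ≤ K) (hT : 1 ≤ T) :
    Submodule.span F {x : Fin N → F |
        ∃ c ∈ GRSCode F N K α v, ∃ c' ∈ GRSCode F N T α w, x = c * c'}
      = (degreeLT F (K + T - 1)).map (grsEncode α (v * w)) := by
  classical
  apply le_antisymm
  · rw [Submodule.span_le, ← GRSCode_eq_map]
    rintro _ ⟨c, hc, d, hd, rfl⟩
    exact mul_mem_GRSCode hK hT hc hd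
  · rw [degreeLT_eq_span_X_pow, Submodule.map_span, Submodule.span_le]
    rintro _ ⟨_, hp, rfl⟩
    obtain ⟨i, hi, rfl⟩ := by simpa using hp
    have X_pow_mem {j k : ℕ} (u : Fin N → F) (h : j < k) :
        grsEncode α u (X ^ j) ∈ GRSCode F N k α u :=
      ⟨X ^ j, by rw [degree_X_pow]; exact_mod_cast h, fun _ => rfl⟩
    refine Submodule.subset_span ⟨_, X_pow_mem v (j := min i (K - 1)) (by omega),
      _, X_pow_mem w (j := i - min i (K - 1)) (by omega), ?_⟩
    rw [← grsEncode_mul, ← pow_add, Nat.add_sub_cancel' (min_le_left _ _)]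

theorem finrank_map_grsEncode (hα : Function.Injective α) (hu : ∀ n, u n ≠ 0) {m : ℕ}
    (hm : m ≤ N) : Module.finrank F ((degreeLT F m).map (grsEncode α u)) = m := by
  have hinj : Function.Injective ((grsEncode α u).domRestrict (degreeLT F m)) := by
    rw [injective_iff_map_eq_zero]
    rintro ⟨p, hp⟩ h
    rw [mem_degreeLT] at hp
    refine Subtype.ext (eq_zero_of_degree_lt_of_eval_index_eq_zero (s := Finset.univ) hα.injOn
      (hp.trans_le (by simpa using hm)) fun n _ => ?_)
    exact (mul_eq_zero.mp (congrFun h n)).resolve_left (hu n)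
  rw [← LinearMap.range_domRestrict, LinearMap.finrank_range_of_inj hinj,
    (degreeLTEquiv F m).finrank_eq, Module.finrank_fin_fun]

theorem sum_mem_GRSCode {k : ℕ} (a : Fin k → F) :
    (fun n => ∑ j : Fin k, a j * (u n * α n ^ (j : ℕ))) ∈ GRSCode F N k α u := by
  refine ⟨∑ j : Fin k, C (a j) * X ^ (j : ℕ), degree_sum_fin_lt a, fun n => ?_⟩
  simp [eval_finsetSum, Finset.mul_sum, mul_left_comm]

end GRS

/-- Schur products of GRS codes.  With pairwise distinct evaluation points
`α` and nonzero weights `v, w`: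
(1) the span of the componentwise products of codewords of `GRS_K(α,v)` and `GRS_T(α,w)`
equals the span of `GRS_{min(K+T-1,N)}(α, v⋆w)` and has dimension `min (K+T-1) N`;
(2) for any matrices `W : F^{ℓ×K}` and `U : F^{ℓ×T}`, with
`x i n = ∑ k, W i k * v n * α n ^ k` and `y i n = ∑ t, U i t * w n * α n ^ t`,
the vector of inner products `(∑ i, x i n * y i n)_n` lies in `GRS_{min(K+T-1,N)}(α, v⋆w)`;
in particular the `N` inner products contain exactly `max (N-K-T+1) 0` redundant symbols. -/
theorem stmt_4 (F : Type*) [Field F] (N K T : ℕ) (hK : 1 ≤ K) (hT : 1 ≤ T)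
    (hKN : K ≤ N) (hTN : T ≤ N)
    (α v w : Fin N → F) (hα : Function.Injective α)
    (hv : ∀ n, v n ≠ 0) (hw : ∀ n, w n ≠ 0) :
    (Submodule.span F {x : Fin N → F |
        ∃ c ∈ GRSCode F N K α v, ∃ c' ∈ GRSCode F N T α w, x = c * c'}
      = Submodule.span F (GRSCode F N (min (K + T - 1) N) α (v * w))
    ∧ Module.finrank F
        ↥(Submodule.span F {x : Fin N → F |
            ∃ c ∈ GRSCode F N K α v, ∃ c' ∈ GRSCode F N T α w, x = c * c'})
        = min (K + T - 1) N)
    ∧ ∀ (ℓ : ℕ), 1 ≤ ℓ →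
        ∀ (W : Matrix (Fin ℓ) (Fin K) F) (U : Matrix (Fin ℓ) (Fin T) F),
          (fun n : Fin N => ∑ i : Fin ℓ,
              (∑ k : Fin K, W i k * (v n * α n ^ (k : ℕ))) *
              (∑ t : Fin T, U i t * (w n * α n ^ (t : ℕ))))
            ∈ GRSCode F N (min (K + T - 1) N) α (v * w) := by
  have hmap : (Polynomial.degreeLT F (K + T - 1)).map (grsEncode α (v * w)) =
      (Polynomial.degreeLT F (min (K + T - 1) N)).map (grsEncode α (v * w)) := by
    rw [← SetLike.coe_set_eq, ← GRSCode_eq_map, ← GRSCode_eq_map, GRSCode_min_length hα]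
  rw [span_mul_GRSCode hK hT, hmap]
  refine ⟨⟨?_, ?_⟩, fun ℓ _ W U => ?_⟩
  · rw [GRSCode_eq_map, Submodule.span_eq]
  · exact finrank_map_grsEncode hα (fun n => mul_ne_zero (hv n) (hw n)) (min_le_right _ _)
  · rw [GRSCode_eq_map, ← hmap]
    have hsum := Submodule.sum_mem _ (t := Finset.univ) fun i _ =>
      (GRSCode_eq_map (K + T - 1)).subset
        (mul_mem_GRSCode hK hT (sum_mem_GRSCode (α := α) (u := v) (W i))
          (sum_mem_GRSCode (α := α) (u := w) (U i)))
    refine Set.mem_of_eq_of_mem (funext fun n => ?_) hsum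
    simp only [Finset.sum_apply, Pi.mul_apply]
end

section
/- Let F be a field with at least N−1 elements, and let v_1, …, v_N be N pairwise distinct vectors from the set C := {(1, x, x²) : x ∈ F} ∪ {(0,0,1)} ⊆ F³. For n ∈ [N], let P_n ⊆ F³ be the orthogonal complement of span{v_n} with respect to the standard bilinear form ⟨a,b⟩ = a_1b_1 + a_2b_2 + a_3b_3, so each P_n is 2-dimensional. Then: (1) for any distinct n_1, n_2 ∈ [N], the intersection P_{n_1} ∩ P_{n_2} has dimension 1; (2) for any pairwise distinct n_1, n_2, n_3 ∈ [N], the three lines P_{n_1}∩P_{n_2}, P_{n_1}∩P_{n_3}, P_{n_2}∩P_{n_3} together span F³ (i.e., choosing a nonzero vector in each of the three intersections yields a linearly independent triple). -/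
/-- The orthogonal complement of `span {v}` in `F³` with respect to the standard bilinear
form, i.e. the kernel of `x ↦ v 0 * x 0 + v 1 * x 1 + v 2 * x 2`. -/
def perpLine (F : Type*) [Field F] (v : Fin 3 → F) : Submodule F (Fin 3 → F) :=
  LinearMap.ker (∑ i : Fin 3, v i • (LinearMap.proj i : (Fin 3 → F) →ₗ[F] F))

section

variable {F : Type*} [Field F]

open Matrix

theorem mem_perpLine {v x : Fin 3 → F} : x ∈ perpLine F v ↔ v ⬝ᵥ x = 0 := by
  simp [perpLine, dotProduct, LinearMap.sum_apply]

theorem finrank_perpLine {v : Fin 3 → F} (hv : v ≠ 0) :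
    Module.finrank F (perpLine F v) = 2 := by
  have hf : (∑ i : Fin 3, v i • (LinearMap.proj i : (Fin 3 → F) →ₗ[F] F)) ≠ 0 := by
    refine fun h ↦ hv (funext fun i ↦ ?_)
    simpa [LinearMap.sum_apply, Pi.single_apply] using LinearMap.congr_fun h (Pi.single i 1)
  have h := Module.Dual.finrank_ker_add_one_of_ne_zero hf
  rw [Module.finrank_fin_fun] at h
  exact Nat.succ_injective h

theorem perpLine_inf_perpLine {a b : Fin 3 → F} (hab : a ⨯₃ b ≠ 0) :
    perpLine F a ⊓ perpLine F b = F ∙ (a ⨯₃ b) := by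
  refine le_antisymm (fun x hx ↦ ?_) ?_
  · obtain ⟨ha, hb⟩ := hx
    rw [SetLike.mem_coe, mem_perpLine] at ha hb
    have hx : (a ⨯₃ b) ⨯₃ x = 0 := by
      rw [cross_cross_eq_smul_sub_smul, ha, hb, zero_smul, zero_smul, sub_zero]
    have hdep := (not_congr crossProduct_ne_zero_iff_linearIndependent).1 (not_not.2 hx)
    rw [LinearIndependent.pair_iff' hab] at hdep
    push Not at hdep
    exact Submodule.mem_span_singleton.2 hdep
  · rw [Submodule.span_singleton_le_iff_mem]
    exact ⟨mem_perpLine.2 (dot_self_cross a b), mem_perpLine.2 (dot_cross_self a b)⟩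

theorem linearIndependent_of_mem_perpLine_inf {a b c u₁ u₂ u₃ : Fin 3 → F}
    (hdet : (Matrix.of ![a, b, c]).det ≠ 0)
    (h₁ : u₁ ∈ perpLine F a ⊓ perpLine F b) (hu₁ : u₁ ≠ 0)
    (h₂ : u₂ ∈ perpLine F a ⊓ perpLine F c) (hu₂ : u₂ ≠ 0)
    (h₃ : u₃ ∈ perpLine F b ⊓ perpLine F c) (hu₃ : u₃ ≠ 0) :
    LinearIndependent F ![u₁, u₂, u₃] := by
  simp only [Submodule.mem_inf, mem_perpLine] at h₁ h₂ h₃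
  have key (u : Fin 3 → F) (hu : u ≠ 0) (ha : a ⬝ᵥ u = 0) (hb : b ⬝ᵥ u = 0) :
      c ⬝ᵥ u ≠ 0 := by
    refine fun hc ↦ hu (Matrix.eq_zero_of_mulVec_eq_zero hdet ?_)
    ext i
    fin_cases i <;> simpa [mulVec]
  have key' (u : Fin 3 → F) (hu : u ≠ 0) (ha : a ⬝ᵥ u = 0) (hc : c ⬝ᵥ u = 0) :
      b ⬝ᵥ u ≠ 0 := fun hb ↦ key u hu ha hb hc
  have key'' (u : Fin 3 → F) (hu : u ≠ 0) (hb : b ⬝ᵥ u = 0) (hc : c ⬝ᵥ u = 0) :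
      a ⬝ᵥ u ≠ 0 := fun ha ↦ key u hu ha hb hc
  rw [Fintype.linearIndependent_iff]
  intro g hg
  have hdot (w : Fin 3 → F) :
      g 0 * (w ⬝ᵥ u₁) + g 1 * (w ⬝ᵥ u₂) + g 2 * (w ⬝ᵥ u₃) = 0 := by
    simpa [Fin.sum_univ_three, dotProduct_add, dotProduct_smul] using congrArg (w ⬝ᵥ ·) hg
  have hc := hdot c
  have hb := hdot b
  have ha := hdot a
  simp only [h₁, h₂, h₃, mul_zero, add_zero, zero_add, mul_eq_zero] at ha hb hc
  intro i
  fin_cases i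
  · exact hc.resolve_right (key u₁ hu₁ h₁.1 h₁.2)
  · exact hb.resolve_right (key' u₂ hu₂ h₂.1 h₂.2)
  · exact ha.resolve_right (key'' u₃ hu₃ h₃.1 h₃.2)

/-- The moment curve in `F³` together with its point at infinity. -/
def momentCurve (F : Type*) [Field F] : Set (Fin 3 → F) :=
  {w | (∃ x : F, w = ![1, x, x ^ 2]) ∨ w = ![0, 0, 1]}

theorem ne_zero_of_mem_momentCurve {a : Fin 3 → F} (ha : a ∈ momentCurve F) : a ≠ 0 := by
  rcases ha with ⟨x, rfl⟩ | rfl <;> simp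

theorem cross_ne_zero_of_mem_momentCurve {a b : Fin 3 → F} (ha : a ∈ momentCurve F)
    (hb : b ∈ momentCurve F) (hab : a ≠ b) : a ⨯₃ b ≠ 0 := by
  rcases ha with ⟨x, rfl⟩ | rfl <;> rcases hb with ⟨y, rfl⟩ | rfl
  · have hxy : x ≠ y := fun h ↦ hab (by rw [h])
    refine fun h ↦ hxy ?_
    simpa [cross_apply, sub_eq_zero, eq_comm] using congrFun h 2
  · simp [cross_apply]
  · simp [cross_apply]
  · exact absurd rfl hab

theorem det_ne_zero_of_mem_momentCurve {a b c : Fin 3 → F} (ha : a ∈ momentCurve F)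
    (hb : b ∈ momentCurve F) (hc : c ∈ momentCurve F) (hab : a ≠ b) (hac : a ≠ c)
    (hbc : b ≠ c) : (Matrix.of ![a, b, c]).det ≠ 0 := by
  rcases ha with ⟨x, rfl⟩ | rfl <;> rcases hb with ⟨y, rfl⟩ | rfl <;>
    rcases hc with ⟨z, rfl⟩ | rfl
  · have hxy : x ≠ y := fun h ↦ hab (by rw [h])
    have hxz : x ≠ z := fun h ↦ hac (by rw [h])
    have hyz : y ≠ z := fun h ↦ hbc (by rw [h])
    have hprod := mul_ne_zero (mul_ne_zero (sub_ne_zero.2 hxy.symm) (sub_ne_zero.2 hxz.symm))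
      (sub_ne_zero.2 hyz.symm)
    convert hprod using 1
    simp [det_fin_three]
    ring
  all_goals
    simp [det_fin_three] at hab hac hbc ⊢ <;> grind

end

/-- Let `F` be a field with at least `N - 1` elements and let
`v 1, …, v N` be pairwise distinct vectors from `C = {(1,x,x²) : x ∈ F} ∪ {(0,0,1)} ⊆ F³`.
Let `P n` be the orthogonal complement of `span {v n}`.  Then each `P n` is 2-dimensional,
(1) any two distinct `P`'s meet in a line, and (2) for pairwise distinct `n₁ n₂ n₃` the
three lines `P n₁ ⊓ P n₂`, `P n₁ ⊓ P n₃`, `P n₂ ⊓ P n₃` span `F³`; equivalently, nonzero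
vectors chosen from the three lines are linearly independent. -/
theorem stmt_5 (F : Type*) [Field F] (N : ℕ)
    (hcard : ((N - 1 : ℕ) : Cardinal) ≤ Cardinal.mk F)
    (v : Fin N → (Fin 3 → F)) (hinj : Function.Injective v)
    (hmem : ∀ n, (∃ x : F, v n = ![1, x, x ^ 2]) ∨ v n = ![0, 0, 1]) :
    (∀ n, Module.finrank F ↥(perpLine F (v n)) = 2)
    ∧ (∀ n₁ n₂ : Fin N, n₁ ≠ n₂ →
        Module.finrank F ↥(perpLine F (v n₁) ⊓ perpLine F (v n₂)) = 1)
    ∧ (∀ n₁ n₂ n₃ : Fin N, n₁ ≠ n₂ → n₁ ≠ n₃ → n₂ ≠ n₃ →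
        ((perpLine F (v n₁) ⊓ perpLine F (v n₂))
          ⊔ (perpLine F (v n₁) ⊓ perpLine F (v n₃))
          ⊔ (perpLine F (v n₂) ⊓ perpLine F (v n₃)) = ⊤)
        ∧ ∀ u₁ u₂ u₃ : Fin 3 → F,
            u₁ ∈ perpLine F (v n₁) ⊓ perpLine F (v n₂) → u₁ ≠ 0 →
            u₂ ∈ perpLine F (v n₁) ⊓ perpLine F (v n₃) → u₂ ≠ 0 →
            u₃ ∈ perpLine F (v n₂) ⊓ perpLine F (v n₃) → u₃ ≠ 0 →
            LinearIndependent F ![u₁, u₂, u₃]) := by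
  have hne {m n : Fin N} (h : m ≠ n) := cross_ne_zero_of_mem_momentCurve (hmem m) (hmem n)
    (hinj.ne h)
  have hmemcross (m n : Fin N) (h : m ≠ n) :
      crossProduct (v m) (v n) ∈ perpLine F (v m) ⊓ perpLine F (v n) := by
    rw [perpLine_inf_perpLine (hne h)]
    exact Submodule.mem_span_singleton_self _
  refine ⟨fun n ↦ finrank_perpLine (ne_zero_of_mem_momentCurve (hmem n)), fun m n h ↦ ?_,
    fun l m n hlm hln hmn ↦ ?_⟩
  · rw [perpLine_inf_perpLine (hne h), finrank_span_singleton (hne h)]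
  · have hdet := det_ne_zero_of_mem_momentCurve (hmem l) (hmem m) (hmem n) (hinj.ne hlm)
      (hinj.ne hln) (hinj.ne hmn)
    refine ⟨?_, fun u₁ u₂ u₃ ↦ linearIndependent_of_mem_perpLine_inf hdet⟩
    have hli := linearIndependent_of_mem_perpLine_inf hdet (hmemcross l m hlm) (hne hlm)
      (hmemcross l n hln) (hne hln) (hmemcross m n hmn) (hne hmn)
    rw [eq_top_iff, ← hli.span_eq_top_of_card_eq_finrank (by simp), Submodule.span_le,
      Set.range_subset_iff]
    intro i
    fin_cases i
    · exact Submodule.mem_sup_left (Submodule.mem_sup_left (hmemcross l m hlm))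
    · exact Submodule.mem_sup_left (Submodule.mem_sup_right (hmemcross l n hln))
    · exact Submodule.mem_sup_right (hmemcross m n hmn)
end

section
/- Let F be a finite field with q elements and let T, T' be integers with 2 ≤ T' < T. Then there exists a collection of q+1 subspaces W_1, …, W_{q+1} of the T'-th exterior power Λ^{T'}(F^T) (an F-vector space of dimension binom(T,T')), each of dimension binom(T−1, T'−1), such that: (1) for any T' pairwise distinct indices i_1, …, i_{T'} ∈ [q+1], the intersection W_{i_1} ∩ ⋯ ∩ W_{i_{T'}} has dimension 1; (2) for any T pairwise distinct indices i_1, …, i_T ∈ [q+1], if for each T'-element subset S ⊆ {i_1,…,i_T} one chooses a nonzero vector u_S in the one-dimensional intersection ⋂_{i∈S} W_i, then the resulting family of binom(T,T') vectors {u_S} is linearly independent, and hence spans Λ^{T'}(F^T). -/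
open ExteriorAlgebra in
/-- The elements of `⋀[K]^n V` annihilated by left multiplication with `v`. -/
noncomputable def exteriorAnnihilator (K : Type*) {V : Type*} [Field K] [AddCommGroup V]
    [Module K V] (n : ℕ) (v : V) : Submodule K (ExteriorAlgebra K V) :=
  ⋀[K]^n V ⊓ LinearMap.ker (LinearMap.mulLeft K (ι K v))

section Annihilator

open Module Set ExteriorAlgebra

universe v

variable {K : Type*} {V : Type v} {I : Type*} [Field K] [AddCommGroup V] [Module K V]
  [LinearOrder I] {n : ℕ}

lemma mem_exteriorAnnihilator {v : V} {x : ExteriorAlgebra K V} :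
    x ∈ exteriorAnnihilator K n v ↔ x ∈ ⋀[K]^n V ∧ ι K v * x = 0 := by
  simp [exteriorAnnihilator]

lemma ι_mul_ιMulti_family_eq_zero (b : I → V) {S : powersetCard I n} {i : I} (hi : i ∈ S.1) :
    ι K (b i) * ιMulti_family K n b S = 0 := by
  obtain ⟨k, hk⟩ := (powersetCard.mem_range_ofFinEmbEquiv_symm_iff_mem S i).mpr hi
  have h := ιMulti_succ_apply (R := K)
    (Fin.cons (b i) (b ∘ powersetCard.ofFinEmbEquiv.symm S) : Fin (n + 1) → V)
  rw [(ιMulti K (n + 1)).map_eq_zero_of_eq (i := 0) (j := k.succ) _ (by simp [hk])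
    (Fin.succ_ne_zero k).symm] at h
  exact h.symm

/-- The projection along `b i` onto the span of the remaining basis vectors. -/
noncomputable def Module.Basis.projErase {κ : Type*} (b : Basis κ K V) (i : κ) : V →ₗ[K] V :=
  LinearMap.id - (b.coord i).smulRight (b i)

lemma Module.Basis.projErase_self {κ : Type*} (b : Basis κ K V) (i : κ) :
    b.projErase i (b i) = 0 := by
  simp [Module.Basis.projErase]

lemma Module.Basis.projErase_of_ne {κ : Type*} (b : Basis κ K V) {i j : κ} (h : j ≠ i) :
    b.projErase i (b j) = b j := by
  simp [Module.Basis.projErase, Finsupp.single_eq_of_ne h.symm]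

lemma map_projErase_eq_zero {κ : Type*} (b : Basis κ K V) (i : κ) {x : ExteriorAlgebra K V}
    (hx : ι K (b i) * x = 0) : ExteriorAlgebra.map (b.projErase i) x = 0 := by
  have h := CliffordAlgebra.contractLeft_ι_mul (Q := (0 : QuadraticForm K V))
    (d := b.coord i) (b i) x
  have hx' : CliffordAlgebra.ι (0 : QuadraticForm K V) (b i) * x = 0 := hx
  rw [hx', map_zero, Basis.coord_apply, Basis.repr_self, Finsupp.single_eq_same, one_smul,
    eq_comm, sub_eq_zero] at h
  rw [h]
  change ExteriorAlgebra.map (b.projErase i) (ι K (b i) * _) = 0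
  rw [map_mul, map_apply_ι, b.projErase_self, map_zero, zero_mul]

lemma exteriorPower_map_projErase_of_notMem (b : Basis I K V) {i : I} {S : powersetCard I n}
    (hi : i ∉ S.1) :
    exteriorPower.map n (b.projErase i) (b.exteriorPower n S) = b.exteriorPower n S := by
  rw [exteriorPower.basis_apply, exteriorPower.ιMulti_family, exteriorPower.map_apply_ιMulti]
  congr 1
  ext k
  refine b.projErase_of_ne ?_
  rintro rfl
  exact hi ((powersetCard.mem_range_ofFinEmbEquiv_symm_iff_mem S _).mp ⟨k, rfl⟩)

lemma coe_exteriorPower_map (f : V →ₗ[K] V) (x : ⋀[K]^n V) :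
    (exteriorPower.map n f x : ExteriorAlgebra K V) = ExteriorAlgebra.map f x := by
  have : (⋀[K]^n V).subtype ∘ₗ exteriorPower.map n f =
      (ExteriorAlgebra.map f).toLinearMap ∘ₗ (⋀[K]^n V).subtype := by
    ext v
    simp
  exact LinearMap.congr_fun this x

lemma exteriorPower_map_projErase_of_mem (b : Basis I K V) {i : I} {S : powersetCard I n}
    (hi : i ∈ S.1) : exteriorPower.map n (b.projErase i) (b.exteriorPower n S) = 0 := by
  apply Subtype.ext
  rw [coe_exteriorPower_map, exteriorPower.basis_apply, exteriorPower.ιMulti_family_apply_coe]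
  exact map_projErase_eq_zero b i (ι_mul_ιMulti_family_eq_zero b hi)

lemma repr_exteriorPower_map_projErase (b : Basis I K V) {i : I} {S : powersetCard I n}
    (hi : i ∉ S.1) (x : ⋀[K]^n V) :
    (b.exteriorPower n).repr (exteriorPower.map n (b.projErase i) x) S =
      (b.exteriorPower n).repr x S := by
  have : (b.exteriorPower n).coord S ∘ₗ exteriorPower.map n (b.projErase i) =
      (b.exteriorPower n).coord S := by
    refine (b.exteriorPower n).ext fun R ↦ ?_
    by_cases hR : i ∈ R.1
    · have hne : R ≠ S := by rintro rfl; exact hi hR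
      rw [LinearMap.comp_apply, exteriorPower_map_projErase_of_mem b hR, map_zero,
        Basis.coord_apply, Basis.repr_self, Finsupp.single_eq_of_ne hne.symm]
    · rw [LinearMap.comp_apply, exteriorPower_map_projErase_of_notMem b hR]
  exact LinearMap.congr_fun this x

lemma repr_eq_zero_of_ι_mul_eq_zero (b : Basis I K V) {i : I} {x : ⋀[K]^n V}
    (hx : ι K (b i) * (x : ExteriorAlgebra K V) = 0) {S : powersetCard I n} (hi : i ∉ S.1) :
    (b.exteriorPower n).repr x S = 0 := by
  have h : exteriorPower.map n (b.projErase i) x = 0 := by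
    apply Subtype.ext
    rw [coe_exteriorPower_map, map_projErase_eq_zero b i hx]
    rfl
  rw [← repr_exteriorPower_map_projErase b hi, h, map_zero, Finsupp.zero_apply]

lemma iInf_exteriorAnnihilator_eq_span (b : Basis I K V) {J : Finset I} (hJ : J.Nonempty) :
    ⨅ i ∈ J, exteriorAnnihilator K n (b i) =
      Submodule.span K (range fun S : {S : powersetCard I n // J ⊆ S.1} ↦
        (b.exteriorPower n S.1 : ExteriorAlgebra K V)) := by
  apply le_antisymm
  · intro x hx
    simp only [Submodule.mem_iInf, mem_exteriorAnnihilator] at hx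
    obtain ⟨i₀, hi₀⟩ := hJ
    lift x to ⋀[K]^n V using (hx i₀ hi₀).1
    have hsum := (b.exteriorPower n).linearCombination_repr x
    rw [← hsum, Finsupp.linearCombination_apply, Finsupp.sum, Submodule.coe_sum]
    refine Submodule.sum_mem _ fun S hS ↦ ?_
    rw [Submodule.coe_smul]
    refine Submodule.smul_mem _ _ (Submodule.subset_span ⟨⟨S, fun i hi ↦ ?_⟩, rfl⟩)
    by_contra hiS
    exact Finsupp.mem_support_iff.mp hS (repr_eq_zero_of_ι_mul_eq_zero b (hx i hi).2 hiS)
  · rw [Submodule.span_le]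
    rintro _ ⟨⟨S, hS⟩, rfl⟩
    simp only [SetLike.mem_coe, Submodule.mem_iInf, mem_exteriorAnnihilator]
    refine fun i hi ↦ ⟨Subtype.property _, ?_⟩
    rw [exteriorPower.basis_apply, exteriorPower.ιMulti_family_apply_coe]
    exact ι_mul_ιMulti_family_eq_zero b (hS hi)

lemma finrank_iInf_exteriorAnnihilator [Fintype I] (b : Basis I K V) {J : Finset I}
    (hJ : J.Nonempty) :
    finrank K ↥(⨅ i ∈ J, exteriorAnnihilator K n (b i)) =
      Nat.card {S : powersetCard I n // J ⊆ S.1} := by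
  rw [iInf_exteriorAnnihilator_eq_span b hJ, Nat.card_eq_fintype_card]
  refine finrank_span_eq_card ?_
  exact ((b.exteriorPower n).linearIndependent.map' (⋀[K]^n V).subtype
    (Submodule.ker_subtype _)).comp _ Subtype.val_injective

lemma card_powersetCard_mem [Fintype I] (i : I) (hn : n ≠ 0) :
    Nat.card {S : powersetCard I n // {i} ⊆ S.1} = (Fintype.card I - 1).choose (n - 1) := by
  obtain ⟨m, rfl⟩ := Nat.exists_eq_succ_of_ne_zero hn
  have e : {S : powersetCard I (m + 1) // {i} ⊆ S.1} ≃
      ((Finset.univ.erase i).powersetCard m : Finset (Finset I)) :=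
    { toFun := fun S ↦ ⟨S.1.1.erase i, by
        have hi : i ∈ S.1.1 := by simpa using S.2
        have hc : S.1.1.card = m + 1 := S.1.2
        rw [Finset.mem_powersetCard, Finset.card_erase_of_mem hi, hc]
        exact ⟨Finset.erase_subset_erase i (Finset.subset_univ _), rfl⟩⟩
      invFun := fun R ↦ ⟨⟨insert i R.1, by
        have h := Finset.mem_powersetCard.mp R.2
        have hi : i ∉ R.1 := fun h' ↦ by simpa using h.1 h'
        change (insert i R.1).card = m + 1
        rw [Finset.card_insert_of_notMem hi, h.2]⟩, by simp⟩
      left_inv := fun S ↦ by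
        have hi : i ∈ S.1.1 := by simpa using S.2
        exact Subtype.ext (Subtype.ext (Finset.insert_erase hi))
      right_inv := fun R ↦ by
        have h := Finset.mem_powersetCard.mp R.2
        have hi : i ∉ R.1 := fun h' ↦ by simpa using h.1 h'
        exact Subtype.ext (Finset.erase_insert hi) }
  rw [Nat.card_congr e, Nat.card_eq_fintype_card, Fintype.card_coe, Finset.card_powersetCard,
    Finset.card_erase_of_mem (Finset.mem_univ i), Finset.card_univ, Nat.succ_sub_one]

/-- After extending `w` to a basis, the dimension of the intersection of the annihilators is the
number of index sets containing those of `w`. -/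
lemma finrank_iInf_exteriorAnnihilator_of_linearIndependent [FiniteDimensional K V]
    {m : ℕ} (hm : m ≠ 0) {w : Fin m → V} (hw : LinearIndependent K w) :
    ∃ (I : Type v) (_ : LinearOrder I) (_ : Fintype I) (J : Finset I),
      J.card = m ∧ Fintype.card I = finrank K V ∧
      finrank K ↥(⨅ j, exteriorAnnihilator K n (w j)) =
        Nat.card {S : powersetCard I n // J ⊆ S.1} := by
  classical
  let b := Basis.sumExtend hw
  let : LinearOrder (Fin m ⊕ Basis.sumExtendIndex hw) := linearOrderOfSTO WellOrderingRel
  let := FiniteDimensional.fintypeBasisIndex b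
  have : NeZero m := ⟨hm⟩
  have hne : (Finset.univ.image (Sum.inl : Fin m → Fin m ⊕ Basis.sumExtendIndex hw)).Nonempty :=
    Finset.univ_nonempty.image _
  have hb (j) : b (Sum.inl j) = w j := by
    simp only [b, Basis.sumExtend, Basis.reindex_apply, Basis.extend_apply_self]
    rfl
  refine ⟨_, inferInstance, inferInstance, Finset.univ.image Sum.inl, ?_,
    (finrank_eq_card_basis b).symm, ?_⟩
  · rw [Finset.card_image_of_injective _ Sum.inl_injective, Finset.card_univ, Fintype.card_fin]
  · have hinf : ⨅ j, exteriorAnnihilator K n (w j) =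
        ⨅ i ∈ Finset.univ.image Sum.inl, exteriorAnnihilator K n (b i) := by
      simp only [Finset.iInf_finset_image, Finset.mem_univ, iInf_pos, hb]
    rw [← finrank_iInf_exteriorAnnihilator b hne, hinf]

lemma finrank_exteriorAnnihilator [FiniteDimensional K V] {v : V} (hv : v ≠ 0) (hn : n ≠ 0) :
    finrank K ↥(exteriorAnnihilator K n v) = (finrank K V - 1).choose (n - 1) := by
  obtain ⟨I, _, _, J, hJ, hI, h⟩ := finrank_iInf_exteriorAnnihilator_of_linearIndependent
    (K := K) (n := n) one_ne_zero (w := fun _ : Fin 1 ↦ v) (.of_subsingleton 0 hv)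
  obtain ⟨i, rfl⟩ := Finset.card_eq_one.mp hJ
  rw [card_powersetCard_mem i hn, hI, iInf_const] at h
  exact h

lemma finrank_iInf_exteriorAnnihilator_eq_one [FiniteDimensional K V] (hn : n ≠ 0)
    {w : Fin n → V} (hw : LinearIndependent K w) :
    finrank K ↥(⨅ j, exteriorAnnihilator K n (w j)) = 1 := by
  obtain ⟨I, _, _, J, hJ, -, h⟩ := finrank_iInf_exteriorAnnihilator_of_linearIndependent
    (n := n) hn hw
  rw [h, Nat.card_eq_one_iff_exists]
  refine ⟨⟨⟨J, hJ⟩, subset_rfl⟩, fun S ↦ Subtype.ext (Subtype.ext ?_)⟩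
  have hS : S.1.1.card = n := S.1.2
  exact (Finset.eq_of_subset_of_card_le S.2 (by rw [hS, hJ])).symm

lemma linearIndependent_and_span_of_mem_iInf_exteriorAnnihilator (b : Basis I K V) (hn : n ≠ 0)
    {u : powersetCard I n → ExteriorAlgebra K V}
    (hu : ∀ S, u S ≠ 0 ∧ u S ∈ ⨅ i ∈ S.1, exteriorAnnihilator K n (b i)) :
    LinearIndependent K u ∧ Submodule.span K (range u) = ⋀[K]^n V := by
  have key (S : powersetCard I n) :
      ∃ c : Kˣ, u S = c • (b.exteriorPower n S : ExteriorAlgebra K V) := by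
    obtain ⟨h0, hmem⟩ := hu S
    have hS : S.1.card = n := S.2
    let : Unique {R : powersetCard I n // S.1 ⊆ R.1} :=
      { default := ⟨S, subset_rfl⟩
        uniq := fun R ↦ Subtype.ext <| Subtype.ext <| .symm <|
          Finset.eq_of_subset_of_card_le R.2 (by
            have hR : R.1.1.card = n := R.1.2
            rw [hR, hS]) }
    rw [iInf_exteriorAnnihilator_eq_span b (Finset.card_ne_zero.mp (by rwa [hS])),
      range_unique, Submodule.mem_span_singleton] at hmem
    obtain ⟨c, hc⟩ := hmem
    have hc0 : c ≠ 0 := by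
      rintro rfl
      exact h0 (by rw [← hc, zero_smul])
    exact ⟨Units.mk0 c hc0, hc.symm⟩
  choose c hc using key
  let B := (b.exteriorPower n).unitsSMul c
  have hB : u = (⋀[K]^n V).subtype ∘ B := by
    ext S
    rw [hc S, Function.comp_apply, Basis.unitsSMul_apply]
    rfl
  rw [hB]
  refine ⟨B.linearIndependent.map' _ (Submodule.ker_subtype _), ?_⟩
  rw [range_comp, ← Submodule.map_span, B.span_eq, Submodule.map_top, Submodule.range_subtype]

end Annihilator

lemma linearIndependent_moment_curve {K α : Type*} [Field K] {T : ℕ} {p : α → Option K}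
    (hp : Function.Injective p) {g : Fin T → α} (hg : Function.Injective g) :
    LinearIndependent K fun i ↦ (fun j : Fin T ↦
      ((p (g i)).getD 1) ^ (j : ℕ) * ((p (g i)).elim 0 fun _ ↦ 1) ^ (j.rev : ℕ)) := by
  let M := Matrix.projVandermonde (fun i ↦ (p (g i)).getD 1)
    (fun i ↦ (p (g i)).elim 0 fun _ ↦ 1)
  have hM : M.det ≠ 0 := by
    rw [Matrix.det_projVandermonde]
    refine Finset.prod_ne_zero_iff.mpr fun i _ ↦ Finset.prod_ne_zero_iff.mpr fun j hj ↦ ?_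
    have hij : p (g i) ≠ p (g j) := fun h ↦ (Finset.mem_Ioi.mp hj).ne (hg (hp h))
    rcases hi : p (g i) with _ | x <;> rcases hj : p (g j) with _ | y <;>
      simp_all [sub_eq_zero, eq_comm]
  exact Matrix.linearIndependent_rows_of_det_ne_zero hM

/-- In `K^T` there are `|K| + 1` vectors of which any `T` or fewer are linearly independent. -/
lemma exists_linearIndependent_of_le (K : Type*) [Field K] [Fintype K] (T : ℕ) :
    ∃ v : Fin (Fintype.card K + 1) → Fin T → K, ∀ m ≤ T, ∀ f : Fin m → Fin (Fintype.card K + 1),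
      Function.Injective f → LinearIndependent K (v ∘ f) := by
  classical
  rcases le_total (Fintype.card K + 1) T with hT | hT
  · refine ⟨fun i ↦ Pi.basisFun K _ (Fin.castLE hT i), fun m _ f hf ↦ ?_⟩
    exact (Pi.basisFun K (Fin T)).linearIndependent.comp (Fin.castLE hT ∘ f)
      ((Fin.castLE_injective hT).comp hf)
  · let p : Fin (Fintype.card K + 1) ≃ Option K :=
      (Fintype.equivFinOfCardEq Fintype.card_option).symm
    refine ⟨fun i j ↦ ((p i).getD 1) ^ (j : ℕ) * ((p i).elim 0 fun _ ↦ 1) ^ (j.rev : ℕ),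
      fun m hm f hf ↦ ?_⟩
    obtain ⟨s, hs, hsT⟩ := Finset.exists_superset_card_eq (s := Finset.univ.image f) (n := T)
      (by simpa [Finset.card_image_of_injective _ hf]) (by simpa)
    let e := (s.orderIsoOfFin hsT).symm
    have hmem (i : Fin m) : f i ∈ s := hs (Finset.mem_image_of_mem f (Finset.mem_univ i))
    have h := (linearIndependent_moment_curve p.injective
      (s.orderEmbOfFin hsT).injective).comp (fun i ↦ e ⟨f i, hmem i⟩) (fun i j hij ↦
        hf (congrArg Subtype.val (e.injective hij)))
    have he (i : Fin m) : s.orderEmbOfFin hsT (e ⟨f i, hmem i⟩) = f i := by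
      rw [← Finset.coe_orderIsoOfFin_apply, OrderIso.apply_symm_apply]
    simpa [Function.comp_def, he] using h


/-- Let `F` be a finite field with `q` elements and `2 ≤ T' < T`.  There
exist `q + 1` subspaces of the `T'`-th exterior power `⋀[F]^T' (F^T)` (a space of dimension
`(T choose T')`), each of dimension `(T-1 choose T'-1)`, such that
(1) any `T'` of them meet in a one-dimensional subspace, and
(2) for any `T` of them, choosing a nonzero vector in the one-dimensional intersection of
each `T'`-element subfamily yields a linearly independent family, which moreover spans
`⋀[F]^T' (F^T)`. -/
theorem stmt_7 (F : Type*) [Field F] [Fintype F] (T T' : ℕ)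
    (hT' : 2 ≤ T') (hT'T : T' < T) :
    ∃ W : Fin (Fintype.card F + 1) →
        Submodule F (ExteriorAlgebra F (Fin T → F)),
      (∀ i, W i ≤ ⋀[F]^T' (Fin T → F))
      ∧ (∀ i, Module.finrank F ↥(W i) = Nat.choose (T - 1) (T' - 1))
      ∧ (∀ f : Fin T' → Fin (Fintype.card F + 1), Function.Injective f →
          Module.finrank F ↥(⨅ j, W (f j)) = 1)
      ∧ (∀ ι : Fin T → Fin (Fintype.card F + 1), Function.Injective ι →
          ∀ u : {S : Finset (Fin T) // S.card = T'} →
              ExteriorAlgebra F (Fin T → F),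
            (∀ S, u S ≠ 0 ∧ u S ∈ ⨅ i ∈ S.1, W (ι i)) →
            LinearIndependent F u
            ∧ Submodule.span F (Set.range u) = ⋀[F]^T' (Fin T → F)) := by
  obtain ⟨v, hv⟩ := exists_linearIndependent_of_le F T
  have hn : T' ≠ 0 := by omega
  refine ⟨fun i ↦ exteriorAnnihilator F T' (v i), fun i ↦ inf_le_left, fun i ↦ ?_, fun f hf ↦ ?_,
    fun g hg u hu ↦ ?_⟩
  · have hi := (hv 1 (by omega) (fun _ ↦ i) (Function.injective_of_subsingleton _)).ne_zero 0
    simpa using finrank_exteriorAnnihilator (K := F) hi hn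
  · exact finrank_iInf_exteriorAnnihilator_eq_one hn (hv T' hT'T.le f hf)
  · have hli := hv T le_rfl g hg
    have : Nonempty (Fin T) := ⟨⟨0, by omega⟩⟩
    let b := basisOfLinearIndependentOfCardEqFinrank hli (by simp)
    refine linearIndependent_and_span_of_mem_iInf_exteriorAnnihilator b hn fun S ↦ ?_
    simpa [b] using hu S
end

section
/- Let F be a field, let V be an F-vector space of finite dimension T, let 2 ≤ T' ≤ T, and let u_1, …, u_{T'} ∈ V be linearly independent. For each i, let W_{u_i} := { u_i ∧ ω : ω ∈ Λ^{T'−1}(V) } ⊆ Λ^{T'}(V). Then ⋂_{i=1}^{T'} W_{u_i} = span{ u_1 ∧ u_2 ∧ ⋯ ∧ u_{T'} }; in particular this intersection is one-dimensional. -/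
/-- A linearly independent family over a field has a dual family of linear forms. -/
lemma LinearIndependent.exists_dual_family {F V I : Type*} [Field F] [AddCommGroup V] [Module F V]
    [DecidableEq I] {u : I → V} (hu : LinearIndependent F u) :
    ∃ φ : I → Module.Dual F V, ∀ i j, φ i (u j) = if i = j then 1 else 0 := by
  obtain ⟨g, hg⟩ := LinearMap.exists_leftInverse_of_injective _
    (LinearMap.ker_eq_bot.mpr hu)
  refine ⟨fun i => Finsupp.lapply i ∘ₗ g, fun i j => ?_⟩
  have h := LinearMap.congr_fun hg (Finsupp.single j 1)
  simp only [LinearMap.comp_apply, Finsupp.linearCombination_single, one_smul,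
    LinearMap.id_apply] at h
  simp [h, Finsupp.single_apply, eq_comm]

namespace ExteriorAlgebra

section CommRing

variable {R M : Type*} [CommRing R] [AddCommGroup M] [Module R M]

/-- Contraction with a linear form on the exterior algebra. -/
noncomputable def contract (d : Module.Dual R M) : ExteriorAlgebra R M →ₗ[R] ExteriorAlgebra R M :=
  CliffordAlgebra.contractLeft (Q := (0 : QuadraticForm R M)) d

lemma contract_ι_mul (d : Module.Dual R M) (v : M) (x : ExteriorAlgebra R M) :
    contract d (ι R v * x) = d v • x - ι R v * contract d x :=
  CliffordAlgebra.contractLeft_ι_mul ..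

lemma contract_mem_exteriorPower (d : Module.Dual R M) {n : ℕ} :
    ∀ {x : ExteriorAlgebra R M}, x ∈ ⋀[R]^(n + 1) M → contract d x ∈ ⋀[R]^n M := by
  induction n with
  | zero =>
    intro x hx
    rw [zero_add, exteriorPower, pow_one] at hx
    obtain ⟨v, rfl⟩ := hx
    rw [exteriorPower, pow_zero, Submodule.mem_one]
    exact ⟨d v, (CliffordAlgebra.contractLeft_ι _ d v).symm⟩
  | succ n ih =>
    intro x hx
    rw [exteriorPower, pow_succ'] at hx
    induction hx using Submodule.mul_induction_on' with
    | mem_mul_mem a ha b hb =>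
      obtain ⟨v, rfl⟩ := ha
      rw [contract_ι_mul]
      refine Submodule.sub_mem _ (Submodule.smul_mem _ _ hb) ?_
      rw [exteriorPower, pow_succ']
      exact Submodule.mul_mem_mul ⟨v, rfl⟩ (ih hb)
    | add a _ b _ iha ihb =>
      rw [map_add]
      exact Submodule.add_mem _ iha ihb

/-- An element annihilated by `v` is divisible by `v`, as soon as some linear form takes the
value `1` at `v`. -/
lemma ι_mul_contract_of_ι_mul_eq_zero {d : Module.Dual R M} {v : M} (hd : d v = 1)
    {x : ExteriorAlgebra R M} (hx : ι R v * x = 0) : ι R v * contract d x = x := by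
  have h := contract_ι_mul d v x
  rw [hx, map_zero, hd, one_smul] at h
  exact (sub_eq_zero.mp h.symm).symm

end CommRing

section Field

variable {F V : Type*} [Field F] [AddCommGroup V] [Module F V]

/-- An element annihilated by every member of a linearly independent family is divisible by the
product of the family. -/
lemma exists_eq_ιMulti_mul {n m : ℕ} {u : Fin n → V} (hu : LinearIndependent F u)
    {x : ExteriorAlgebra F V} (hx : x ∈ ⋀[F]^(m + n) V) (hux : ∀ i, ι F (u i) * x = 0) :
    ∃ y ∈ ⋀[F]^m V, x = ιMulti F n u * y := by
  induction n generalizing x with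
  | zero => exact ⟨x, hx, by simp⟩
  | succ n ih =>
    obtain ⟨φ, hφ⟩ := hu.exists_dual_family
    have hx0 := ι_mul_contract_of_ι_mul_eq_zero (d := φ 0) (by simp [hφ]) (hux 0)
    obtain ⟨y, hy, hxy⟩ := ih (u := Matrix.vecTail u) (hu.comp _ (Fin.succ_injective n))
      (contract_mem_exteriorPower (φ 0) hx) fun i => by
        have h := contract_ι_mul (φ 0) (u i.succ) x
        rw [hux, map_zero, hφ, if_neg (Fin.succ_ne_zero i).symm, zero_smul, zero_sub] at h
        exact neg_eq_zero.mp h.symm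
    exact ⟨y, hy, by rw [ιMulti_succ_apply, mul_assoc, ← hxy, hx0]⟩

lemma ιMulti_ne_zero {n : ℕ} {u : Fin n → V} (hu : LinearIndependent F u) :
    ιMulti F n u ≠ 0 := by
  have h := (exteriorPower.ιMulti_family_linearIndependent_field (n := n) hu).ne_zero
    (Set.powersetCard.ofFinEmbEquiv (RelEmbedding.refl _))
  intro h0
  apply h
  ext
  simpa [exteriorPower.ιMulti_family, Function.comp_def] using h0

/-- The elements of degree `n` divisible by each of `n` linearly independent vectors are the
multiples of the product of these vectors. -/
lemma iInf_map_mulLeft_ι {n : ℕ} (hn : n ≠ 0) {u : Fin n → V} (hu : LinearIndependent F u) :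
    (⨅ i, Submodule.map (LinearMap.mulLeft F (ι F (u i))) (⋀[F]^(n - 1) V)) =
      Submodule.span F {ιMulti F n u} := by
  obtain ⟨k, rfl⟩ := Nat.exists_eq_succ_of_ne_zero hn
  apply le_antisymm
  · intro x hx
    rw [Submodule.mem_iInf] at hx
    have hdeg : x ∈ ⋀[F]^(0 + (k + 1)) V := by
      obtain ⟨w, hw, rfl⟩ := hx 0
      rw [zero_add, exteriorPower, pow_succ']
      exact Submodule.mul_mem_mul ⟨u 0, rfl⟩ hw
    obtain ⟨y, hy, rfl⟩ := exists_eq_ιMulti_mul hu hdeg fun i => by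
      obtain ⟨w, -, hw⟩ := hx i
      rw [← hw, LinearMap.mulLeft_apply, ← mul_assoc, ι_sq_zero, zero_mul]
    rw [exteriorPower, pow_zero, Submodule.mem_one] at hy
    obtain ⟨c, rfl⟩ := hy
    exact Submodule.mem_span_singleton.mpr ⟨c, by rw [← Algebra.commutes, Algebra.smul_def]⟩
  · rw [Submodule.span_singleton_le_iff_mem, Submodule.mem_iInf]
    intro i
    obtain ⟨φ, hφ⟩ := hu.exists_dual_family
    refine ⟨contract (φ i) (ιMulti F _ u), contract_mem_exteriorPower _
      (ιMulti_range F _ ⟨u, rfl⟩), ι_mul_contract_of_ι_mul_eq_zero (by simp [hφ]) ?_⟩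
    rw [ιMulti_apply, ι_mul_prod_list]

end Field

end ExteriorAlgebra


/-- Let `V` be an `F`-vector space of dimension `T`, `2 ≤ T' ≤ T`, and
`u₁, …, u_{T'} ∈ V` linearly independent.  For each `i` let
`W (u i) = {u i ∧ ω : ω ∈ ⋀[F]^(T'-1) V} ⊆ ⋀[F]^T' V` (the image of the `(T'-1)`-st
exterior power under left wedge-multiplication by `u i`).  Then
`⋂ i, W (u i) = span {u₁ ∧ u₂ ∧ ⋯ ∧ u_{T'}}`; in particular the intersection is
one-dimensional. -/
theorem stmt_8 (F : Type*) [Field F] (V : Type*) [AddCommGroup V] [Module F V]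
    [FiniteDimensional F V] (T T' : ℕ) (hdim : Module.finrank F V = T)
    (hT' : 2 ≤ T') (hT'T : T' ≤ T)
    (u : Fin T' → V) (hu : LinearIndependent F u) :
    (⨅ i : Fin T',
        Submodule.map (LinearMap.mulLeft F (ExteriorAlgebra.ι F (u i)))
          (⋀[F]^(T' - 1) V))
      = Submodule.span F {(List.ofFn fun i => ExteriorAlgebra.ι F (u i)).prod}
    ∧ Module.finrank F
        ↥(⨅ i : Fin T',
            Submodule.map (LinearMap.mulLeft F (ExteriorAlgebra.ι F (u i)))
              (⋀[F]^(T' - 1) V)) = 1 := by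
  rw [← ExteriorAlgebra.ιMulti_apply, ExteriorAlgebra.iInf_map_mulLeft_ι (by lia) hu]
  exact ⟨rfl, finrank_span_singleton (ExteriorAlgebra.ιMulti_ne_zero hu)⟩
end

section
/- Let F be a field, let V be a finite-dimensional F-vector space, let N ≥ 3 and d, L be natural numbers, and let A_1, …, A_N be subspaces of V with dim A_i = d for all i and dim(A_1 + ⋯ + A_N) ≥ L. Suppose that for each i ∈ {3, …, N}, B_i is a subspace of V with B_i ⊆ A_i and B_i ⊆ A_1 + ⋯ + A_{i−1}. Then Σ_{i=3}^N dim B_i ≤ N·d − L. -/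
/-- If each `B i` lies in `A i` and in the sum of the `A j` with `j < i`, then the total dimension
of the `B i` is at most the defect `∑ dim (A i) - dim (∑ A i)`. -/
theorem sum_finrank_add_finrank_sup_le {ι F V : Type*} [LinearOrder ι] [Field F]
    [AddCommGroup V] [Module F V] [FiniteDimensional F V] (A B : ι → Submodule F V)
    (s : Finset ι) (hBA : ∀ i ∈ s, B i ≤ A i)
    (hB : ∀ i ∈ s, B i ≤ {j ∈ s | j < i}.sup A) :
    ∑ i ∈ s, Module.finrank F (B i) + Module.finrank F ↥(s.sup A) ≤
      ∑ i ∈ s, Module.finrank F (A i) := by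
  induction s using Finset.induction_on_max with
  | empty => simp
  | insert a s hs ih =>
    have has : a ∉ s := fun h => lt_irrefl a (hs a h)
    have hfilter : {j ∈ insert a s | j < a} = s := by
      ext j
      simp only [Finset.mem_filter, Finset.mem_insert]
      exact ⟨fun h => h.1.resolve_left h.2.ne, fun h => ⟨Or.inr h, hs j h⟩⟩
    have ih' := ih (fun i hi => hBA i (Finset.mem_insert_of_mem hi)) fun i hi => by
      have h := hB i (Finset.mem_insert_of_mem hi)
      rwa [Finset.filter_insert, if_neg (hs i hi).not_gt] at h
    have hBa := hB a (Finset.mem_insert_self a s)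
    rw [hfilter] at hBa
    have hle : Module.finrank F (B a) ≤ Module.finrank F ↥(A a ⊓ s.sup A) :=
      Submodule.finrank_mono (le_inf (hBA a (Finset.mem_insert_self a s)) hBa)
    have hdim := Submodule.finrank_sup_add_finrank_inf_eq (A a) (s.sup A)
    rw [Finset.sum_insert has, Finset.sum_insert has, Finset.sup_insert]
    omega


/-- Let `V` be a finite-dimensional `F`-vector space, `N ≥ 3`, and let
`A 0, …, A (N-1)` be subspaces of `V`, each of dimension `d`, whose sum has dimension at
least `L`.  Suppose that for each `i` with `2 ≤ i` (i.e. `i ∈ {3, …, N}` in 1-based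
indexing) `B i` is a subspace with `B i ≤ A i` and `B i ≤ A 0 + ⋯ + A (i-1)`.  Then
`∑_{i ≥ 2} dim (B i) ≤ N·d − L`. -/
theorem stmt_10 (F : Type*) [Field F] (V : Type*) [AddCommGroup V] [Module F V]
    [FiniteDimensional F V] (N d L : ℕ) (hN : 3 ≤ N)
    (A B : Fin N → Submodule F V)
    (hA : ∀ i, Module.finrank F ↥(A i) = d)
    (hL : L ≤ Module.finrank F ↥(⨆ i, A i))
    (hBA : ∀ i : Fin N, 2 ≤ (i : ℕ) → B i ≤ A i)
    (hBsum : ∀ i : Fin N, 2 ≤ (i : ℕ) →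
      B i ≤ ⨆ j : Fin N, ⨆ _ : (j : ℕ) < (i : ℕ), A j) :
    ((∑ i ∈ Finset.univ.filter fun i : Fin N => 2 ≤ (i : ℕ),
        Module.finrank F ↥(B i) : ℕ) : ℤ) ≤ (N : ℤ) * (d : ℤ) - (L : ℤ) := by
  have key := sum_finrank_add_finrank_sup_le A (fun i => if 2 ≤ (i : ℕ) then B i else ⊥)
    Finset.univ
    (fun i _ => by
      split_ifs with h
      · exact hBA i h
      · exact bot_le)
    (fun i _ => by
      split_ifs with h
      · refine (hBsum i h).trans (iSup₂_le fun j hj => ?_)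
        exact Finset.le_sup (f := A) (by simpa using hj)
      · exact bot_le)
  have hsum : ∑ i : Fin N, Module.finrank F ↥(if 2 ≤ (i : ℕ) then B i else ⊥) =
      ∑ i ∈ Finset.univ.filter fun i : Fin N => 2 ≤ (i : ℕ), Module.finrank F ↥(B i) := by
    rw [Finset.sum_filter]
    refine Finset.sum_congr rfl fun i _ => ?_
    by_cases h : 2 ≤ (i : ℕ)
    · rw [if_pos h, if_pos h]
    · rw [if_neg h, if_neg h, finrank_bot]
  rw [hsum, Finset.sup_univ_eq_iSup] at key
  simp only [hA, Finset.sum_const, Finset.card_univ, Fintype.card_fin, smul_eq_mul] at key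
  have hle := (Nat.add_le_add_left hL _).trans key
  zify at hle ⊢
  linarith
end

section
/- Let F be a field, let d ≥ 1 and N ≥ 3 be integers, and let G be a 2×N matrix over F such that any two columns of G are linearly independent. For (x,y) ∈ F^d × F^d and n ∈ [N], write w_n(x,y) := G_{1,n}·x + G_{2,n}·y ∈ F^d. Let V_1, …, V_N be subspaces of the dual space (F^d)*. Fix i ∈ {3, …, N} and let φ ∈ ( Σ_{j=2}^{i−1} (V_1 ∩ V_j) ) ∩ (V_1 ∩ V_i). Then the linear functional F^d × F^d → F given by (x,y) ↦ φ(w_i(x,y)) lies in the F-linear span of the set of functionals { (x,y) ↦ ψ(w_j(x,y)) : j ∈ [i−1], ψ ∈ V_j } inside the space of linear maps from F^d × F^d to F. -/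
theorem exists_eq_smul_add_smul_of_linearIndependent_pair {F : Type*} [Field F]
    {u v : Fin 2 → F} (h : LinearIndependent F ![u, v]) (z : Fin 2 → F) :
    ∃ a b : F, z = a • u + b • v := by
  have htop := h.span_eq_top_of_card_eq_finrank' (by simp)
  have hz : z ∈ Submodule.span F {u, v} := by
    rw [← Matrix.range_cons_cons_empty u v ![], htop]
    exact Submodule.mem_top
  obtain ⟨a, b, hab⟩ := Submodule.mem_span_pair.mp hz
  exact ⟨a, b, hab.symm⟩

/-- Let `G` be a `2 × N` matrix over `F` (`N ≥ 3`) any two of whose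
columns are linearly independent, and for `n` let `w n : F^d × F^d → F^d` be the linear map
`(x, y) ↦ G 0 n • x + G 1 n • y`.  Let `V 0, …, V (N-1)` be subspaces of the dual of `F^d`
(`V 0` is the query space of server 1).  Fix `i` with `2 ≤ i` (i.e. `i ∈ {3, …, N}` in
1-based indexing) and let `φ ∈ (∑_{1 ≤ j < i} (V 0 ⊓ V j)) ⊓ (V 0 ⊓ V i)`.  Then the
functional `(x, y) ↦ φ (w i (x, y))` lies in the span of the functionals
`(x, y) ↦ ψ (w j (x, y))` for `j < i` and `ψ ∈ V j`. -/
theorem stmt_11 (F : Type*) [Field F] (d N : ℕ) (hd : 1 ≤ d) (hN : 3 ≤ N)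
    (G : Matrix (Fin 2) (Fin N) F)
    (hG : ∀ n₁ n₂ : Fin N, n₁ ≠ n₂ →
      LinearIndependent F ![fun i => G i n₁, fun i => G i n₂])
    (V : Fin N → Submodule F (Module.Dual F (Fin d → F)))
    (i : Fin N) (hi : 2 ≤ (i : ℕ))
    (φ : Module.Dual F (Fin d → F))
    (hφ : φ ∈ (⨆ j : Fin N, ⨆ _ : 1 ≤ (j : ℕ) ∧ (j : ℕ) < (i : ℕ),
                  (V (⟨0, by omega⟩ : Fin N) ⊓ V j))
            ⊓ (V (⟨0, by omega⟩ : Fin N) ⊓ V i)) :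
    φ.comp (G 0 i • LinearMap.fst F (Fin d → F) (Fin d → F)
            + G 1 i • LinearMap.snd F (Fin d → F) (Fin d → F))
      ∈ Submodule.span F
        { f : ((Fin d → F) × (Fin d → F)) →ₗ[F] F |
          ∃ j : Fin N, (j : ℕ) < (i : ℕ) ∧ ∃ ψ ∈ V j,
            f = ψ.comp (G 0 j • LinearMap.fst F (Fin d → F) (Fin d → F)
                        + G 1 j • LinearMap.snd F (Fin d → F) (Fin d → F)) } := by
  set w : Fin N → ((Fin d → F) × (Fin d → F)) →ₗ[F] (Fin d → F) := fun n =>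
    G 0 n • LinearMap.fst F (Fin d → F) (Fin d → F)
      + G 1 n • LinearMap.snd F (Fin d → F) (Fin d → F) with hw
  set S := Submodule.span F { f : ((Fin d → F) × (Fin d → F)) →ₗ[F] F |
    ∃ j : Fin N, (j : ℕ) < (i : ℕ) ∧ ∃ ψ ∈ V j, f = ψ.comp (w j) } with hS
  suffices h : (⨆ j : Fin N, ⨆ _ : 1 ≤ (j : ℕ) ∧ (j : ℕ) < (i : ℕ),
      (V (⟨0, by omega⟩ : Fin N) ⊓ V j)) ≤ S.comap (LinearMap.lcomp F F (w i)) from h hφ.1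
  refine iSup₂_le fun j hj ψ hψ => ?_
  have hne : (⟨0, by omega⟩ : Fin N) ≠ j := fun h => by
    have := congrArg Fin.val h
    simp only at this
    omega
  obtain ⟨a, b, hab⟩ :=
    exists_eq_smul_add_smul_of_linearIndependent_pair (hG _ j hne) (fun k => G k i)
  have h0 := congrFun hab 0
  have h1 := congrFun hab 1
  simp only [Pi.add_apply, Pi.smul_apply, smul_eq_mul] at h0 h1
  have hwi : w i = a • w ⟨0, by omega⟩ + b • w j := by
    simp only [hw, h0, h1]
    module
  have hcomp : ψ.comp (w i) = a • ψ.comp (w ⟨0, by omega⟩) + b • ψ.comp (w j) := by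
    rw [hwi, LinearMap.comp_add, LinearMap.comp_smul, LinearMap.comp_smul]
  change ψ.comp (w i) ∈ S
  rw [hcomp]
  exact S.add_mem
    (S.smul_mem a (Submodule.subset_span ⟨_, by simp only; omega, ψ, hψ.1, rfl⟩))
    (S.smul_mem b (Submodule.subset_span ⟨j, hj.2, ψ, hψ.2, rfl⟩))
end
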